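/- arXiv:2110.07142 — 2 statements merged into one kernel-verified Lean document; each statement's English description precedes it below -/
import Mathlib

section
/- For every integer k ≥ 1 there exists a constant C > 0 (depending on k, χ and φ) such that exp(−k𝔉(s)) · |𝔉^{(k)}(s)| ≤ C for all s ∈ (0,1), where 𝔉^{(k)} denotes the k-th derivative of 𝔉. -/
open Set Filter MeasureTheory

open scoped Topology

/-- Successive derivatives of `s ↦ c - log (1 - s) - log (s - p)` on `(p, 1)`. -/
lemma iteratedDeriv_eq_of_eqOn_neg_log {F : ℝ → ℝ} {p a c : ℝ} (hpa : p < a)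
    (hF : ∀ s ∈ Ioo a 1, F s = c - Real.log (1 - s) - Real.log (s - p)) (n : ℕ) :
    ∀ s ∈ Ioo a 1, iteratedDeriv (n + 1) F s =
      n.factorial * ((1 - s)⁻¹ ^ (n + 1) + (-1) ^ (n + 1) * (s - p)⁻¹ ^ (n + 1)) := by
  induction n with
  | zero =>
    intro s hs
    have h1 : 1 - s ≠ 0 := (sub_pos.2 hs.2).ne'
    have h2 : s - p ≠ 0 := (sub_pos.2 (hpa.trans hs.1)).ne'
    have hev : F =ᶠ[𝓝 s] fun t => c - Real.log (1 - t) - Real.log (t - p) := by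
      filter_upwards [isOpen_Ioo.mem_nhds hs] with t ht using hF t ht
    rw [zero_add, iteratedDeriv_one, hev.deriv_eq]
    have hd := ((((hasDerivAt_id s).const_sub 1).log h1).const_sub c).sub
      (((hasDerivAt_id s).sub_const p).log h2)
    refine hd.deriv.trans ?_
    simp only [id, Nat.factorial_zero, Nat.cast_one]
    field_simp
    ring
  | succ n ih =>
    intro s hs
    have h1 : 1 - s ≠ 0 := (sub_pos.2 hs.2).ne'
    have h2 : s - p ≠ 0 := (sub_pos.2 (hpa.trans hs.1)).ne'
    have hev : iteratedDeriv (n + 1) F =ᶠ[𝓝 s] fun t =>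
        n.factorial * ((1 - t)⁻¹ ^ (n + 1) + (-1) ^ (n + 1) * (t - p)⁻¹ ^ (n + 1)) := by
      filter_upwards [isOpen_Ioo.mem_nhds hs] with t ht using ih t ht
    rw [iteratedDeriv_succ, hev.deriv_eq]
    have hd := (((((hasDerivAt_id s).const_sub 1).fun_inv h1).fun_pow (n + 1)).fun_add
      (((((hasDerivAt_id s).sub_const p).fun_inv h2).fun_pow (n + 1)).const_mul
        ((-1 : ℝ) ^ (n + 1)))).const_mul (n.factorial : ℝ)
    refine hd.deriv.trans ?_
    simp only [id, Nat.factorial_succ, Nat.cast_mul, Nat.add_sub_cancel, Nat.cast_add,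
      Nat.cast_one, div_eq_mul_inv, ← inv_pow]
    ring

/-- Near a logarithmic singularity the weight `exp (-k F)` absorbs the `k`-th derivative. -/
lemma exp_mul_abs_iteratedDeriv_le_of_eqOn_neg_log {F : ℝ → ℝ} {p a c : ℝ} (hp : 0 ≤ p)
    (hpa : p < a) (hF : ∀ s ∈ Ioo a 1, F s = c - Real.log (1 - s) - Real.log (s - p)) (n : ℕ) :
    ∀ s ∈ Ioo a 1, Real.exp (-((n + 1 : ℕ) : ℝ) * F s) * |iteratedDeriv (n + 1) F s| ≤
      Real.exp (-((n + 1 : ℕ) : ℝ) * c) * (n.factorial * 2) := by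
  intro s hs
  have h1 : 0 < 1 - s := sub_pos.2 hs.2
  have h2 : 0 < s - p := sub_pos.2 (hpa.trans hs.1)
  have h1' : 1 - s ≤ 1 := by linarith [hs.1]
  have h2' : s - p ≤ 1 := by linarith [hs.2]
  have hexp : Real.exp (-((n + 1 : ℕ) : ℝ) * F s) =
      Real.exp (-((n + 1 : ℕ) : ℝ) * c) * ((1 - s) ^ (n + 1) * (s - p) ^ (n + 1)) := by
    have e : -((n + 1 : ℕ) : ℝ) * F s = -((n + 1 : ℕ) : ℝ) * c +
        (((n + 1 : ℕ) : ℝ) * Real.log (1 - s) + ((n + 1 : ℕ) : ℝ) * Real.log (s - p)) := by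
      rw [hF s hs]; ring
    rw [e, Real.exp_add, Real.exp_add, Real.exp_nat_mul, Real.exp_nat_mul, Real.exp_log h1,
      Real.exp_log h2]
  have hbound : |iteratedDeriv (n + 1) F s| ≤
      n.factorial * ((1 - s)⁻¹ ^ (n + 1) + (s - p)⁻¹ ^ (n + 1)) := by
    rw [iteratedDeriv_eq_of_eqOn_neg_log hpa hF n s hs, abs_mul, Nat.abs_cast]
    gcongr
    refine (abs_add_le _ _).trans_eq ?_
    rw [abs_mul, abs_pow (-1 : ℝ), abs_neg, abs_one, one_pow, one_mul,
      abs_of_pos (pow_pos (inv_pos.2 h1) _), abs_of_pos (pow_pos (inv_pos.2 h2) _)]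
  have hx := pow_le_one₀ (n := n + 1) h1.le h1'
  have hy := pow_le_one₀ (n := n + 1) h2.le h2'
  calc _ ≤ Real.exp (-((n + 1 : ℕ) : ℝ) * c) * ((1 - s) ^ (n + 1) * (s - p) ^ (n + 1)) *
        (n.factorial * ((1 - s)⁻¹ ^ (n + 1) + (s - p)⁻¹ ^ (n + 1))) := by
        rw [hexp]; gcongr
    _ = Real.exp (-((n + 1 : ℕ) : ℝ) * c) *
        (n.factorial * ((s - p) ^ (n + 1) + (1 - s) ^ (n + 1))) := by
        rw [inv_pow, inv_pow]
        field_simp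
    _ ≤ _ := by gcongr; linarith

/-- The profile `-log (1 - ((s - 1 + χ) / χ) ^ 2)` in factored form. -/
lemma neg_log_one_sub_sq_div {χ s : ℝ} (hχ : 0 < χ) (hs : s ∈ Ioo (1 - χ) 1) :
    -Real.log (1 - ((s - 1 + χ) / χ) ^ 2) =
      Real.log (χ ^ 2) - Real.log (1 - s) - Real.log (s - (1 - 2 * χ)) := by
  have h1 : 1 - s ≠ 0 := (sub_pos.2 hs.2).ne'
  have h2 : s - (1 - 2 * χ) ≠ 0 := (by linarith [hs.1] : 0 < s - (1 - 2 * χ)).ne'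
  have e : 1 - ((s - 1 + χ) / χ) ^ 2 = (1 - s) * (s - (1 - 2 * χ)) / χ ^ 2 := by
    field_simp
    ring
  rw [e, Real.log_div (mul_ne_zero h1 h2) (by positivity), Real.log_mul h1 h2]
  ring

/-- With `χ`, `f`, `f'`, `φ`, `𝔉` as in the construction of the exhaustion
function (so `𝔉(s) = ∫₀ˢ φ(τ) f'(τ) dτ` is infinitely differentiable on `(0,1)`):
for every integer `k ≥ 1` there exists a constant `C > 0` such that
`exp(-k·𝔉(s)) · |𝔉⁽ᵏ⁾(s)| ≤ C` for all `s ∈ (0,1)`. -/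
theorem stmt1
    (χ : ℝ) (hχ : χ ∈ Set.Ioo (0:ℝ) (1/8))
    (f f' φ 𝔉 : ℝ → ℝ)
    (hf0 : ∀ s ∈ Set.Icc (0:ℝ) (1 - χ), f s = 0)
    (hf1 : ∀ s ∈ Set.Ioo (1 - χ) (1:ℝ), f s = -Real.log (1 - ((s - 1 + χ) / χ)^2))
    (hfderiv : ∀ s ∈ Set.Ico (0:ℝ) 1, HasDerivAt f (f' s) s)
    (hf'0 : ∀ s ∈ Set.Icc (0:ℝ) (1 - χ), f' s = 0)
    (hφsmooth : ContDiff ℝ (⊤ : ℕ∞) φ)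
    (hφ01 : ∀ s, φ s ∈ Set.Icc (0:ℝ) 1)
    (hφ0 : ∀ s : ℝ, s ≤ 1 - χ + χ^2 → φ s = 0)
    (hφ1 : ∀ s : ℝ, 1 - χ + 2 * χ^2 ≤ s → φ s = 1)
    (hφ' : ∀ s : ℝ, deriv φ s ∈ Set.Icc (0:ℝ) (2 / χ^2))
    (h𝔉 : ∀ s : ℝ, 𝔉 s = ∫ τ in (0:ℝ)..s, φ τ * f' τ)
    (h𝔉smooth : ContDiffOn ℝ (⊤ : ℕ∞) 𝔉 (Set.Ioo 0 1)) :
    ∀ k : ℕ, 1 ≤ k → ∃ C : ℝ, 0 < C ∧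
      ∀ s ∈ Set.Ioo (0:ℝ) 1,
        Real.exp (-(k : ℝ) * 𝔉 s) * |iteratedDeriv k 𝔉 s| ≤ C := by
  obtain ⟨hχ0, hχ8⟩ := hχ
  set b := 1 - χ + χ ^ 2 with hb
  set a := 1 - χ + 2 * χ ^ 2 with ha
  set p := 1 - 2 * χ with hp
  have hχ2 : 0 < χ ^ 2 := by positivity
  have hb0 : 0 < b := by linarith
  have hχb : 1 - χ < b := by linarith
  have hba : b < a := by linarith
  have ha1 : a < 1 := by nlinarith
  have hpχ : p < 1 - χ := by linarith
  have hf'eq : ∀ s ∈ Ioo (1 - χ) 1, f' s = (1 - s)⁻¹ - (s - p)⁻¹ := by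
    intro s hs
    have h1 : 1 - s ≠ 0 := (sub_pos.2 hs.2).ne'
    have h2 : s - p ≠ 0 := (sub_pos.2 (hpχ.trans hs.1)).ne'
    have hev : f =ᶠ[𝓝 s] fun t => Real.log (χ ^ 2) - Real.log (1 - t) - Real.log (t - p) := by
      filter_upwards [isOpen_Ioo.mem_nhds hs] with t ht
      rw [hf1 t ht, neg_log_one_sub_sq_div hχ0 ht]
    have hd := ((((hasDerivAt_id s).const_sub 1).log h1).const_sub (Real.log (χ ^ 2))).sub
      (((hasDerivAt_id s).sub_const p).log h2)
    refine ((hfderiv s ⟨by linarith [hs.1], hs.2⟩).unique (hd.congr_of_eventuallyEq hev)).trans ?_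
    simp only [id]
    field_simp
  have hf'cont : ContinuousOn f' (Ioo (1 - χ) 1) := by
    refine ContinuousOn.congr ?_ hf'eq
    refine ContinuousOn.sub (ContinuousOn.inv₀ (by fun_prop) fun t ht => ?_)
      (ContinuousOn.inv₀ (by fun_prop) fun t ht => ?_)
    · exact (sub_pos.2 ht.2).ne'
    · exact (sub_pos.2 (hpχ.trans ht.1)).ne'
  have hzero : ∀ s ≤ b, ∀ τ ∈ uIcc 0 s, 0 ≤ s → φ τ * f' τ = 0 := by
    intro s hs τ hτ h0
    rw [uIcc_of_le h0] at hτ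
    rw [hφ0 τ (hτ.2.trans hs), zero_mul]
  have h𝔉0 : ∀ s ∈ Ioo 0 b, 𝔉 s = 0 := by
    intro s hs
    rw [h𝔉, intervalIntegral.integral_congr (g := fun _ => (0 : ℝ))
      fun τ hτ => hzero s hs.2.le τ hτ hs.1.le]
    simp
  have hint : ∀ x y, 1 - χ < x → x ≤ y → y < 1 →
      IntervalIntegrable f' volume x y ∧
        IntervalIntegrable (fun τ => φ τ * f' τ) volume x y := by
    intro x y hx hxy hy
    have hc : ContinuousOn f' (uIcc x y) := by
      rw [uIcc_of_le hxy]
      exact hf'cont.mono (Icc_subset_Ioo hx hy)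
    exact ⟨hc.intervalIntegrable,
      (hφsmooth.continuous.continuousOn.mul hc).intervalIntegrable⟩
  have hint0 : IntervalIntegrable (fun τ => φ τ * f' τ) volume 0 a := by
    refine IntervalIntegrable.trans (b := b) ?_ (hint b a hχb hba.le ha1).2
    refine (intervalIntegrable_const (c := (0 : ℝ))).congr fun τ hτ => ?_
    exact (hzero b le_rfl τ (uIoc_subset_uIcc hτ) hb0.le).symm
  have h𝔉1 : ∀ s ∈ Ioo a 1,
      𝔉 s = (𝔉 a - f a + Real.log (χ ^ 2)) - Real.log (1 - s) - Real.log (s - p) := by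
    intro s hs
    have hi := hint a s (hχb.trans hba) hs.1.le hs.2
    have h1 : 𝔉 s = 𝔉 a + ∫ τ in a..s, φ τ * f' τ := by
      rw [h𝔉 s, h𝔉 a, intervalIntegral.integral_add_adjacent_intervals hint0 hi.2]
    have h2 : ∫ τ in a..s, φ τ * f' τ = ∫ τ in a..s, f' τ := by
      refine intervalIntegral.integral_congr fun τ hτ => ?_
      rw [uIcc_of_le hs.1.le] at hτ
      simp only [hφ1 τ hτ.1, one_mul]
    have h3 : ∫ τ in a..s, f' τ = f s - f a := by
      refine intervalIntegral.integral_eq_sub_of_hasDerivAt (fun τ hτ => ?_) hi.1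
      rw [uIcc_of_le hs.1.le] at hτ
      exact hfderiv τ ⟨by linarith [hτ.1], hτ.2.trans_lt hs.2⟩
    have hs' : s ∈ Ioo (1 - χ) 1 := ⟨by linarith [hs.1], hs.2⟩
    rw [h1, h2, h3, hf1 s hs', neg_log_one_sub_sq_div hχ0 hs']
    ring
  intro k hk
  obtain ⟨n, rfl⟩ : ∃ n, k = n + 1 := ⟨k - 1, by omega⟩
  have hcont : ContinuousOn (fun s => Real.exp (-((n + 1 : ℕ) : ℝ) * 𝔉 s) *
      |iteratedDeriv (n + 1) 𝔉 s|) (Icc b a) := by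
    have hsub : Icc b a ⊆ Ioo (0 : ℝ) 1 := Icc_subset_Ioo hb0 ha1
    have hD : ContinuousOn (iteratedDeriv (n + 1) 𝔉) (Ioo 0 1) :=
      (h𝔉smooth.continuousOn_iteratedDerivWithin (by exact_mod_cast le_top)
        isOpen_Ioo.uniqueDiffOn).congr fun s hs =>
          (iteratedDerivWithin_of_isOpen isOpen_Ioo hs).symm
    exact ((continuousOn_const.mul h𝔉smooth.continuousOn).rexp.mul hD.abs).mono hsub
  obtain ⟨M, hM⟩ := isCompact_Icc.bddAbove_image hcont
  refine ⟨max (max 1 M) (Real.exp (-((n + 1 : ℕ) : ℝ) * (𝔉 a - f a + Real.log (χ ^ 2))) *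
    (n.factorial * 2)), by positivity, fun s hs => ?_⟩
  rcases lt_or_ge s b with hsb | hsb
  · have hev : 𝔉 =ᶠ[𝓝 s] fun _ => (0 : ℝ) := by
      filter_upwards [isOpen_Ioo.mem_nhds (show s ∈ Ioo 0 b from ⟨hs.1, hsb⟩)] with t ht
        using h𝔉0 t ht
    rw [hev.iteratedDeriv_eq]
    simp only [iteratedDeriv_const, Nat.succ_ne_zero, if_false, abs_zero, mul_zero]
    positivity
  rcases le_or_gt s a with hsa | hsa
  · exact (hM (mem_image_of_mem _ ⟨hsb, hsa⟩)).trans ((le_max_right _ _).trans (le_max_left _ _))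
  · exact (exp_mul_abs_iteratedDeriv_le_of_eqOn_neg_log (by linarith)
      (hpχ.trans (hχb.trans hba)) h𝔉1 n s ⟨hsa, hs.2⟩).trans (le_max_right _ _)
end

section
/- Let R₀ ≥ 0 and T > 0 with 4 R₀ T ≤ 1, and let r : [0, T] → ℝ be a differentiable function with r(t) ≥ 0 and |r′(t)| ≤ (R₀/2)·r(t) for all t ∈ [0, T]. Define h(t) = − r(t)² / (16 (2T − t)). Then for every t ∈ [0, T], h′(t) ≤ − r(t)² / (32 (2T − t)²). -/
open Set

/-- Let `R₀ ≥ 0` and `T > 0` with `4R₀T ≤ 1`, and let `r : [0,T] → ℝ` be a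
differentiable function with `r(t) ≥ 0` and `|r'(t)| ≤ (R₀/2)·r(t)` for all `t ∈ [0,T]`.
Define `h(t) = -r(t)²/(16(2T - t))`.  Then `h'(t) ≤ -r(t)²/(32(2T - t)²)` for every
`t ∈ [0,T]`. -/
theorem stmt9 (R₀ T : ℝ) (hR₀ : 0 ≤ R₀) (hT : 0 < T) (hRT : 4 * R₀ * T ≤ 1)
    (r r' h : ℝ → ℝ)
    (hr : ∀ t ∈ Set.Icc (0:ℝ) T, HasDerivAt r (r' t) t)
    (hrnonneg : ∀ t ∈ Set.Icc (0:ℝ) T, 0 ≤ r t)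
    (hr' : ∀ t ∈ Set.Icc (0:ℝ) T, |r' t| ≤ (R₀ / 2) * r t)
    (hh : ∀ t : ℝ, h t = -(r t)^2 / (16 * (2 * T - t))) :
    ∀ t ∈ Set.Icc (0:ℝ) T, deriv h t ≤ -(r t)^2 / (32 * (2 * T - t)^2) := by
  intro t ht
  obtain ⟨ht0, htT⟩ := ht
  have hs : 0 < 2 * T - t := by linarith
  have hden : HasDerivAt (fun u : ℝ => 16 * (2 * T - u)) (16 * -1) t :=
    ((hasDerivAt_id t).const_sub (2 * T)).const_mul 16
  have hderiv := (((hr t ⟨ht0, htT⟩).fun_pow 2).fun_neg).fun_div hden (by positivity)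
  rw [funext hh, hderiv.deriv, div_le_div_iff₀ (by positivity) (by positivity)]
  have hR : 2 * R₀ * (2 * T - t) ≤ 1 := by nlinarith
  have key : -(4 * (r t * r' t) * (2 * T - t)) ≤ r t ^ 2 := by
    have hr0 := hrnonneg t ⟨ht0, htT⟩
    calc -(4 * (r t * r' t) * (2 * T - t))
        = 4 * r t * (2 * T - t) * -r' t := by ring
      _ ≤ 4 * r t * (2 * T - t) * (R₀ / 2 * r t) := by
          gcongr
          exact (neg_le_abs _).trans (hr' t ⟨ht0, htT⟩)
      _ = 2 * R₀ * (2 * T - t) * r t ^ 2 := by ring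
      _ ≤ 1 * r t ^ 2 := by gcongr
      _ = r t ^ 2 := one_mul _
  push_cast
  linear_combination 256 * (2 * T - t) ^ 2 * key
end
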